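/- Any finite metric space on k points embeds into ℝ (dimension 1) with distortion at most 12k; that is, there exists a map φ : X → ℝ such that d_X(x, x̃) ≤ |φ(x) − φ(x̃)| ≤ 12k · d_X(x, x̃) for all x, x̃ ∈ X. -/

import Mathlib

/-- The graph on a metric space joining distinct points at distance at most `r`. -/
def proximityGraph (X : Type*) [MetricSpace X] (r : ℝ) : SimpleGraph X where
  Adj x y := x ≠ y ∧ dist x y ≤ r
  symm := ⟨fun x y h => ⟨h.1.symm, by rw [dist_comm]; exact h.2⟩⟩
  loopless := ⟨fun _ h => h.1 rfl⟩

open scoped Classical in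
/-- The set of points reachable from `x` by steps of length at most `r`. -/
noncomputable def proximityCluster {X : Type*} [MetricSpace X] [Fintype X] (r : ℝ) (x : X) :
    Finset X :=
  Finset.univ.filter fun y => (proximityGraph X r).Reachable x y

section

variable {X : Type*} [MetricSpace X] {r : ℝ} {x y : X}

lemma reachable_proximityGraph_of_dist_le (h : dist x y ≤ r) :
    (proximityGraph X r).Reachable x y := by
  by_cases hxy : x = y
  · rw [hxy]
  · exact SimpleGraph.Adj.reachable ⟨hxy, h⟩

lemma dist_le_length_mul (p : (proximityGraph X r).Walk x y) : dist x y ≤ p.length * r := by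
  induction p with
  | nil => simp
  | cons h p ih =>
    rw [SimpleGraph.Walk.length_cons]
    push_cast
    linarith [dist_triangle _ _ _ |>.trans (add_le_add h.2 ih)]

/-- A non-contracting map on a finite set extends to a further point close to the set, at the
price of enlarging the range by `2 * r`. -/
lemma exists_noncontracting_insert [DecidableEq X] (hr : 0 ≤ r) {S : Finset X} {L : ℝ} {g : X → ℝ}
    (hg : ∀ a ∈ S, ∀ b ∈ S, dist a b ≤ |g a - g b|) (hL : ∀ a ∈ S, 0 ≤ g a ∧ g a ≤ L)
    (hy : y ∈ S) (hx : x ∉ S) (hxy : dist y x ≤ r) :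
    ∃ g' : X → ℝ, (∀ a ∈ insert x S, ∀ b ∈ insert x S, dist a b ≤ |g' a - g' b|) ∧
      ∀ a ∈ insert x S, 0 ≤ g' a ∧ g' a ≤ L + 2 * r := by
  let g' : X → ℝ := fun z => if z = x then g y + r else if g z ≤ g y then g z else g z + 2 * r
  have hg'x : g' x = g y + r := by simp [g']
  have hg' : ∀ a ∈ S, g' a = if g a ≤ g y then g a else g a + 2 * r := fun a ha => by
    simp [g', show a ≠ x from fun h => hx (h ▸ ha)]
  have key : ∀ a ∈ S, dist a x ≤ |g' a - g' x| := fun a ha => by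
    have h1 := hg a ha y hy
    have h2 := dist_triangle a y x
    rw [hg' a ha, hg'x]
    split_ifs with h
    · rw [abs_of_nonpos (by linarith)] at h1 ⊢
      linarith
    · rw [abs_of_nonneg (by linarith)] at h1 ⊢
      linarith
  refine ⟨g', fun a ha b hb => ?_, fun a ha => ?_⟩
  · rcases Finset.mem_insert.1 ha with rfl | ha' <;> rcases Finset.mem_insert.1 hb with rfl | hb'
    · simp
    · rw [dist_comm, abs_sub_comm]
      exact key b hb'
    · exact key a ha'
    · refine (hg a ha' b hb').trans ?_
      rw [hg' a ha', hg' b hb']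
      split_ifs with h1 h2 h2
      · rfl
      · rw [abs_of_nonpos (by linarith), abs_of_nonpos (by linarith)]
        linarith
      · rw [abs_of_nonneg (by linarith), abs_of_nonneg (by linarith)]
        linarith
      · rw [add_sub_add_right_eq_sub]
  · rcases Finset.mem_insert.1 ha with rfl | ha
    · have := hL y hy
      rw [hg'x]
      constructor <;> linarith
    · have := hL a ha
      rw [hg' a ha]
      split_ifs <;> constructor <;> linarith

variable [Fintype X]

lemma mem_proximityCluster :
    y ∈ proximityCluster r x ↔ (proximityGraph X r).Reachable x y := by
  simp [proximityCluster]

lemma proximityCluster_congr (h : (proximityGraph X r).Reachable x y) :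
    proximityCluster r x = proximityCluster r y := by
  ext z
  simp only [mem_proximityCluster]
  exact ⟨fun hz => h.symm.trans hz, fun hz => h.trans hz⟩

lemma dist_le_card_proximityCluster_mul (hr : 0 ≤ r)
    (h : (proximityGraph X r).Reachable x y) :
    dist x y ≤ (proximityCluster r x).card * r := by
  classical
  obtain ⟨p, hp⟩ := h.exists_isPath
  refine (dist_le_length_mul p).trans (mul_le_mul_of_nonneg_right ?_ hr)
  have hsub : p.support.toFinset ⊆ proximityCluster r x := fun z hz =>
    mem_proximityCluster.2 ⟨p.takeUntil z (List.mem_toFinset.1 hz)⟩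
  have hcard := Finset.card_le_card hsub
  rw [List.toFinset_card_of_nodup hp.support_nodup, SimpleGraph.Walk.length_support] at hcard
  exact_mod_cast (Nat.le_succ _).trans hcard

lemma exists_noncontracting_proximityCluster (hr : 0 ≤ r) (x : X) :
    ∃ g : X → ℝ, (∀ a ∈ proximityCluster r x, ∀ b ∈ proximityCluster r x,
        dist a b ≤ |g a - g b|) ∧
      ∀ a ∈ proximityCluster r x, 0 ≤ g a ∧ g a ≤ 2 * (proximityCluster r x).card * r := by
  classical
  let good : Finset X → Prop := fun S => x ∈ S ∧ S ⊆ proximityCluster r x ∧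
    ∃ g : X → ℝ, (∀ a ∈ S, ∀ b ∈ S, dist a b ≤ |g a - g b|) ∧
      ∀ a ∈ S, 0 ≤ g a ∧ g a ≤ 2 * S.card * r
  have hne : (Finset.univ.filter good).Nonempty := ⟨{x}, by
    simp only [Finset.mem_filter, Finset.mem_univ, true_and]
    exact ⟨by simp, by simp [mem_proximityCluster], fun _ => 0, by simp, by simp [hr]⟩⟩
  obtain ⟨S, hS, hmax⟩ := Finset.exists_max_image _ Finset.card hne
  obtain ⟨hxS, hSsub, g, hg, hL⟩ := (Finset.mem_filter.1 hS).2
  suffices hsub : proximityCluster r x ⊆ S by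
    rw [hsub.antisymm hSsub]
    exact ⟨g, hg, hL⟩
  intro z hz
  by_contra hzS
  obtain ⟨p⟩ := mem_proximityCluster.1 hz
  obtain ⟨d, -, hd1, hd2⟩ := p.exists_boundary_dart (S : Set X) hxS hzS
  obtain ⟨g', hg', hL'⟩ := exists_noncontracting_insert hr hg hL hd1 hd2 d.adj.2
  have hcard := Finset.card_insert_of_notMem (Finset.mem_coe.not.1 hd2)
  have := hmax (insert d.snd S) (Finset.mem_filter.2 ⟨Finset.mem_univ _,
    Finset.mem_insert_of_mem hxS, Finset.insert_subset (mem_proximityCluster.2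
      ((mem_proximityCluster.1 (hSsub hd1)).trans d.adj.reachable)) hSsub, g', hg', fun a ha => by
        rw [hcard]
        push_cast
        have := hL' a ha
        constructor <;> linarith⟩)
  omega

/-- Representatives of the clusters at scale `r`. -/
lemma exists_cluster_representative (X : Type*) [MetricSpace X] (r : ℝ) :
    ∃ s : X → X, (∀ x, (proximityGraph X r).Reachable x (s x)) ∧
      ∀ x y, (proximityGraph X r).Reachable x y → s x = s y := by
  refine ⟨fun x => ((proximityGraph X r).connectedComponentMk x).out, fun x => ?_, fun x y h => ?_⟩
  · exact SimpleGraph.ConnectedComponent.exact (Quot.out_eq _).symm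
  · exact congrArg Quot.out (SimpleGraph.ConnectedComponent.sound h)

lemma exists_noncontracting_of_reachable (X : Type*) [MetricSpace X] [Fintype X] (hr : 0 ≤ r) :
    ∃ g : X → ℝ, (∀ x y, (proximityGraph X r).Reachable x y → dist x y ≤ |g x - g y|) ∧
      ∀ x, 0 ≤ g x ∧ g x ≤ 2 * (proximityCluster r x).card * r := by
  choose G hG hL using fun x : X => exists_noncontracting_proximityCluster hr x
  obtain ⟨s, hs, hs'⟩ := exists_cluster_representative X r
  refine ⟨fun x => G (s x) x, fun x y h => ?_, fun x => ?_⟩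
  · have := hG (s x) x (mem_proximityCluster.2 (hs x).symm) y
      (mem_proximityCluster.2 ((hs x).symm.trans h))
    simpa only [← hs' x y h] using this
  · rw [proximityCluster_congr (hs x)]
    exact hL (s x) x (mem_proximityCluster.2 (hs x).symm)

/-- `f` embeds every cluster at scale `r` into an interval whose length is at most `6 * r` times
the size of the cluster, without contraction and with Lipschitz constant `K`. -/
structure IsClusterEmbedding (r K : ℝ) (f : X → ℝ) : Prop where
  dist_le : ∀ x y, (proximityGraph X r).Reachable x y → dist x y ≤ |f x - f y|
  le_mul_dist : ∀ x y, (proximityGraph X r).Reachable x y → |f x - f y| ≤ K * dist x y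
  nonneg : ∀ x, 0 ≤ f x
  le_card : ∀ x, f x ≤ 6 * (proximityCluster r x).card * r

lemma IsClusterEmbedding.exists_double (hr : 0 ≤ r) {f : X → ℝ}
    (hf : IsClusterEmbedding r (12 * Fintype.card X) f) :
    ∃ f' : X → ℝ, IsClusterEmbedding (2 * r) (12 * Fintype.card X) f' := by
  classical
  obtain ⟨g, hg, hL⟩ := exists_noncontracting_of_reachable X (r := 2 * r) (by linarith)
  obtain ⟨s, hs, hs'⟩ := exists_cluster_representative X r
  have hmono : ∀ x y, (proximityGraph X r).Reachable x y →
      (proximityGraph X (2 * r)).Reachable x y := fun x y h =>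
    h.mono fun a b (hab : (proximityGraph X r).Adj a b) => ⟨hab.1, hab.2.trans (by linarith)⟩
  let B : X → Finset X := fun x => (proximityCluster (2 * r) x).filter fun z => g (s z) < g (s x)
  let f' : X → ℝ := fun x => f x + g (s x) + (proximityCluster r x).card * r + 8 * r * (B x).card
  have hBcongr : ∀ x y, (proximityGraph X r).Reachable x y → B x = B y := fun x y h => by
    simp only [B, proximityCluster_congr (hmono x y h), hs' x y h]
  have hdisj : ∀ x, Disjoint (B x) (proximityCluster r x) := fun x => by
    refine Finset.disjoint_left.2 fun z hz hz' => ?_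
    have h1 := (Finset.mem_filter.1 hz).2
    rw [hs' x z (mem_proximityCluster.1 hz')] at h1
    exact lt_irrefl _ h1
  have hsub : ∀ x, proximityCluster r x ⊆ proximityCluster (2 * r) x := fun x z hz =>
    mem_proximityCluster.2 (hmono _ _ (mem_proximityCluster.1 hz))
  have hBcard : ∀ x, ((B x).card + (proximityCluster r x).card : ℝ) ≤
      (proximityCluster (2 * r) x).card := fun x => by
    have := Finset.card_le_card (Finset.union_subset (Finset.filter_subset _ _) (hsub x) :
      B x ∪ proximityCluster r x ⊆ _)
    rw [Finset.card_union_of_disjoint (hdisj x)] at this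
    exact_mod_cast this
  have hdiff : ∀ x y, (proximityGraph X r).Reachable x y → f' x - f' y = f x - f y :=
    fun x y h => by
      simp only [f', hBcongr x y h, hs' x y h, proximityCluster_congr h]
      ring
  have hnonneg : ∀ x, 0 ≤ f' x := fun x => by
    have h1 := hf.nonneg x
    have h2 := (hL (s x)).1
    positivity
  have hle : ∀ x, f' x ≤ 6 * (proximityCluster (2 * r) x).card * (2 * r) := fun x => by
    have h1 := hf.le_card x
    have h2 := (hL (s x)).2
    rw [← proximityCluster_congr (hmono _ _ (hs x))] at h2
    have h3 := mul_le_mul_of_nonneg_right (hBcard x) hr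
    have h4 : 0 ≤ ((proximityCluster r x).card : ℝ) * r := by positivity
    simp only [f']
    linarith
  have hsep : ∀ x y, (proximityGraph X (2 * r)).Reachable x y → g (s x) < g (s y) →
      dist x y ≤ f' y - f' x := fun x y hxy hlt => by
    have hBsub : B x ∪ proximityCluster r x ⊆ B y := by
      intro z hz
      rw [Finset.mem_filter, ← proximityCluster_congr hxy]
      rcases Finset.mem_union.1 hz with hz | hz
      · exact ⟨(Finset.mem_filter.1 hz).1, (Finset.mem_filter.1 hz).2.trans hlt⟩
      · exact ⟨hsub x hz, by rwa [← hs' x z (mem_proximityCluster.1 hz)]⟩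
    have hcard := Finset.card_le_card hBsub
    rw [Finset.card_union_of_disjoint (hdisj x)] at hcard
    have hcard' : ((B x).card + (proximityCluster r x).card : ℝ) ≤ (B y).card := by
      exact_mod_cast hcard
    have h1 := mul_le_mul_of_nonneg_right hcard' hr
    have h2 := hg (s x) (s y) (((hmono _ _ (hs x)).symm.trans hxy).trans (hmono _ _ (hs y)))
    rw [abs_of_neg (by linarith)] at h2
    have h3 := dist_le_card_proximityCluster_mul hr (hs x)
    have h4 := dist_le_card_proximityCluster_mul hr (hs y)
    have h5 := dist_triangle4 x (s x) (s y) y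
    rw [dist_comm (s y) y] at h5
    have h6 := hf.le_card x
    have h7 := hf.nonneg y
    simp only [f']
    linarith
  refine ⟨f', fun x y h => ?_, fun x y h => ?_, hnonneg, hle⟩
  · by_cases hxy : (proximityGraph X r).Reachable x y
    · rw [hdiff x y hxy]
      exact hf.dist_le x y hxy
    · rcases lt_trichotomy (g (s x)) (g (s y)) with hlt | heq | hlt
      · rw [abs_sub_comm]
        exact (hsep x y h hlt).trans (le_abs_self _)
      · have h2 := hg (s x) (s y) (((hmono _ _ (hs x)).symm.trans h).trans (hmono _ _ (hs y)))
        rw [heq, sub_self, abs_zero, dist_le_zero] at h2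
        exact absurd ((hs x).trans (h2 ▸ (hs y).symm)) hxy
      · rw [dist_comm]
        exact (hsep y x h.symm hlt).trans (le_abs_self _)
  · by_cases hxy : (proximityGraph X r).Reachable x y
    · rw [hdiff x y hxy]
      exact hf.le_mul_dist x y hxy
    · have hd : r ≤ dist x y :=
        (lt_of_not_ge fun hd => hxy (reachable_proximityGraph_of_dist_le hd)).le
      have h1 := hle x
      have h2 := hle y
      rw [← proximityCluster_congr h] at h2
      have hc : ((proximityCluster (2 * r) x).card : ℝ) ≤ Fintype.card X := by
        exact_mod_cast Finset.card_le_univ _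
      calc |f' x - f' y| ≤ 6 * (proximityCluster (2 * r) x).card * (2 * r) :=
            abs_sub_le_of_nonneg_of_le (hnonneg x) h1 (hnonneg y) h2
        _ = 12 * ((proximityCluster (2 * r) x).card * r) := by ring
        _ ≤ 12 * (Fintype.card X * dist x y) := by gcongr
        _ = 12 * Fintype.card X * dist x y := by ring

lemma isClusterEmbedding_zero {K : ℝ} (hr : 0 ≤ r) (h : ∀ x y : X, x ≠ y → r < dist x y) :
    IsClusterEmbedding r K (fun _ : X => 0) := by
  have heq : ∀ x y : X, (proximityGraph X r).Reachable x y → x = y := by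
    rintro x y ⟨p⟩
    cases p with
    | nil => rfl
    | cons hadj p => exact absurd hadj.2 (h _ _ hadj.1).not_ge
  refine ⟨fun x y hxy => ?_, fun x y hxy => ?_, fun _ => le_rfl, fun x => by positivity⟩ <;>
  simp [heq x y hxy]

end

/-- Any finite metric space on `k` points embeds into `ℝ` with distortion at most `12k`:
there is a non-contracting map `φ : X → ℝ` with
`d_X(x, x̃) ≤ |φ x − φ x̃| ≤ 12k · d_X(x, x̃)` for all `x, x̃`. -/
theorem stmt6 {X : Type*} [MetricSpace X] [Fintype X] (k : ℕ)
    (hk : Fintype.card X = k) (hk1 : 1 ≤ k) :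
    ∃ φ : X → ℝ, ∀ x x' : X,
      dist x x' ≤ |φ x - φ x'| ∧ |φ x - φ x'| ≤ 12 * k * dist x x' := by
  have hsmall : ∀ᶠ r in nhdsWithin (0 : ℝ) (Set.Ioi 0), ∀ x y : X, x ≠ y → r < dist x y := by
    refine Filter.eventually_all.2 fun x => Filter.eventually_all.2 fun y => ?_
    by_cases hxy : x = y
    · simp [hxy]
    · filter_upwards [Ioo_mem_nhdsGT (dist_pos.2 hxy)] with r hr _ using hr.2
  obtain ⟨r, hr, hr0⟩ := (hsmall.and self_mem_nhdsWithin).exists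
  have hr0 : 0 < r := hr0
  have hstep : ∀ n : ℕ, ∃ f : X → ℝ, IsClusterEmbedding (2 ^ n * r) (12 * Fintype.card X) f := by
    intro n
    induction n with
    | zero =>
      rw [pow_zero, one_mul]
      exact ⟨_, isClusterEmbedding_zero hr0.le hr⟩
    | succ n ih =>
      obtain ⟨f, hf⟩ := ih
      rw [pow_succ', mul_assoc]
      exact hf.exists_double (by positivity)
  have hlarge : ∀ᶠ n : ℕ in Filter.atTop, ∀ x y : X, dist x y ≤ 2 ^ n * r :=
    Filter.eventually_all.2 fun x => Filter.eventually_all.2 fun y =>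
      ((tendsto_pow_atTop_atTop_of_one_lt one_lt_two).atTop_mul_const hr0).eventually_ge_atTop _
  obtain ⟨n, hn⟩ := hlarge.exists
  obtain ⟨f, hf⟩ := hstep n
  subst hk
  exact ⟨f, fun x y =>
    ⟨hf.dist_le x y (reachable_proximityGraph_of_dist_le (hn x y)),
      hf.le_mul_dist x y (reachable_proximityGraph_of_dist_le (hn x y))⟩⟩
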